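/- arXiv:2402.08544 — 8 statements merged into one kernel-verified Lean document; each statement's English description precedes it below -/
import Mathlib

section
/- Let m ≥ 0 and let 𝓕 : [0,∞) → [0,∞) be continuous with compact support. Then the functions a ↦ ∫₀^∞ R² √(m²a² + R²) 𝓕(R²) dR and a ↦ ∫₀^∞ R⁴ (m²a² + R²)^{−1/2} 𝓕(R²) dR (i.e. ρ(a)/(4π) and 3p(a)/(4π)) are real-analytic on (0, ∞). -/
open MeasureTheory Real Filter Topology Set

/-- FLRW Vlasov energy density:
`ρ(a) = 4π ∫₀^∞ R² √(m²a² + R²) 𝓕(R²) dR`. -/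
noncomputable def vlasovRho (m : ℝ) (F : ℝ → ℝ) (a : ℝ) : ℝ :=
  4 * π * ∫ R in Ioi (0 : ℝ), R ^ 2 * Real.sqrt (m ^ 2 * a ^ 2 + R ^ 2) * F (R ^ 2)

/-- FLRW Vlasov pressure:
`p(a) = (4π/3) ∫₀^∞ R⁴ (m²a² + R²)^(−1/2) 𝓕(R²) dR`. -/
noncomputable def vlasovP (m : ℝ) (F : ℝ → ℝ) (a : ℝ) : ℝ :=
  4 * π / 3 * ∫ R in Ioi (0 : ℝ), R ^ 4 / Real.sqrt (m ^ 2 * a ^ 2 + R ^ 2) * F (R ^ 2)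

lemma vl_aux_slit {w : ℂ} (hw : 0 < w.re) (R : ℝ) : w + (R:ℂ)^2 ∈ Complex.slitPlane := by
  left
  have : ((R:ℂ)^2).re = R^2 := by rw [← Complex.ofReal_pow, Complex.ofReal_re]
  rw [Complex.add_re, this]; positivity

lemma vl_aux_diff (s : ℂ) (k : ℝ → ℝ) (hk : Continuous k) (M : ℝ) (w₀ : ℂ) (hw₀ : 0 < w₀.re) :
    DifferentiableAt ℂ (fun w : ℂ => ∫ R in Ioc 0 M, (k R : ℂ) * (w + (R:ℂ)^2) ^ s) w₀ := by
  have hball : ∀ w ∈ Metric.closedBall w₀ (w₀.re/2), 0 < w.re := by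
    intro w hw
    have h1 : |(w - w₀).re| ≤ w₀.re/2 :=
      (Complex.abs_re_le_norm _).trans (by simpa [dist_eq_norm] using hw)
    rw [Complex.sub_re] at h1
    have := (abs_le.1 h1).1
    linarith
  have hcont : ∀ t : ℂ, ContinuousOn (fun p : ℂ × ℝ => (k p.2 : ℂ) * (p.1 + (p.2:ℂ)^2) ^ t)
      (Metric.closedBall w₀ (w₀.re/2) ×ˢ Icc 0 M) := by
    intro t
    apply ContinuousOn.mul
    · fun_prop
    · apply ContinuousOn.cpow_const
      · fun_prop
      · rintro ⟨w, R⟩ ⟨hw, -⟩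
        exact vl_aux_slit (hball w hw) R
  have hsec : ∀ t : ℂ, ∀ w : ℂ, 0 < w.re → Continuous (fun R : ℝ => (k R : ℂ) * (w + (R:ℂ)^2) ^ t) := by
    intro t w hw
    apply Continuous.mul
    · fun_prop
    · rw [continuous_iff_continuousAt]
      intro R
      apply ContinuousAt.cpow _ continuousAt_const
      · exact vl_aux_slit hw R
      · fun_prop
  obtain ⟨C, hC⟩ := ((isCompact_closedBall w₀ (w₀.re/2)).prod (isCompact_Icc (a := (0:ℝ)) (b := M))).exists_bound_of_continuousOn
    (hcont (s-1))
  have key := hasDerivAt_integral_of_dominated_loc_of_deriv_le (𝕜 := ℂ)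
    (μ := volume.restrict (Ioc (0:ℝ) M))
    (F := fun (w : ℂ) (R : ℝ) => (k R : ℂ) * (w + (R:ℂ)^2) ^ s)
    (F' := fun (w : ℂ) (R : ℝ) => s * ((k R : ℂ) * (w + (R:ℂ)^2) ^ (s-1)))
    (x₀ := w₀) (s := Metric.closedBall w₀ (w₀.re/2)) (bound := fun _ => ‖s‖ * C)
    (Metric.closedBall_mem_nhds _ (by positivity)) ?_ ?_ ?_ ?_ ?_ ?_
  · exact key.2.differentiableAt
  · filter_upwards [Metric.closedBall_mem_nhds w₀ (half_pos hw₀)] with w hw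
    exact (hsec s w (hball w hw)).aestronglyMeasurable
  · exact ((hsec s w₀ hw₀).integrableOn_Icc (a := 0) (b := M)).mono_set Ioc_subset_Icc_self
  · exact ((hsec (s-1) w₀ hw₀).const_mul s).aestronglyMeasurable
  · filter_upwards [ae_restrict_mem measurableSet_Ioc] with R hR w hw
    rw [norm_mul]
    exact mul_le_mul_of_nonneg_left (hC (w, R) ⟨hw, Ioc_subset_Icc_self hR⟩) (norm_nonneg _)
  · exact integrable_const _
  · refine Eventually.of_forall fun R w hw => ?_
    have h := (((hasDerivAt_id w).add_const ((R:ℂ)^2)).cpow_const (c := s)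
      (vl_aux_slit (hball w hw) R)).const_mul (k R : ℂ)
    refine h.congr_deriv ?_
    simp only [id]
    ring

lemma vl_aux_an (s : ℝ) (k : ℝ → ℝ) (hk : Continuous k) (M : ℝ) (hM : ∀ R, M < R → k R = 0)
    (w₀ : ℝ) (hw₀ : 0 < w₀) :
    AnalyticAt ℝ (fun w : ℝ => ∫ R in Ioi 0, k R * (w + R^2) ^ s) w₀ := by
  have h1 : AnalyticAt ℂ (fun w : ℂ => ∫ R in Ioc 0 M, (k R : ℂ) * (w + (R:ℂ)^2) ^ (s:ℂ)) (w₀:ℂ) := by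
    rw [Complex.analyticAt_iff_eventually_differentiableAt]
    have : ∀ᶠ w : ℂ in 𝓝 (w₀:ℂ), 0 < w.re :=
      (isOpen_lt continuous_const Complex.continuous_re).mem_nhds (by simpa using hw₀)
    filter_upwards [this] with w hw
    exact vl_aux_diff s k hk M w hw
  refine h1.re_ofReal.congr ?_
  filter_upwards [lt_mem_nhds hw₀] with w hw
  have e1 : ∀ R : ℝ, (k R : ℂ) * ((w:ℂ) + (R:ℂ)^2) ^ (s:ℂ) = ((k R * (w + R^2) ^ s : ℝ) : ℂ) := by
    intro R
    rw [Complex.ofReal_mul, Complex.ofReal_cpow (by positivity)]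
    push_cast
    rfl
  simp only [e1]
  rw [integral_complex_ofReal, Complex.ofReal_re]
  refine (setIntegral_eq_of_subset_of_forall_sdiff_eq_zero measurableSet_Ioi Ioc_subset_Ioi_self ?_).symm
  rintro R ⟨hR, hR'⟩
  rw [hM R, zero_mul]
  by_contra h
  exact hR' ⟨hR, not_lt.1 h⟩

/-- for `m ≥ 0` and `𝓕` continuous, compactly supported and nonnegative,
the FLRW Vlasov energy density `a ↦ ρ(a)/(4π)`-integral and pressure
`a ↦ 3p(a)/(4π)`-integral are real-analytic on `(0,∞)`. -/
theorem vlasovRho_vlasovP_analyticAt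
    (m : ℝ) (hm : 0 ≤ m) (F : ℝ → ℝ)
    (hFcont : Continuous F) (hFsupp : HasCompactSupport F) (hFpos : ∀ x, 0 ≤ F x) :
    ∀ a ∈ Ioi (0 : ℝ), AnalyticAt ℝ (vlasovRho m F) a ∧ AnalyticAt ℝ (vlasovP m F) a := by
  intro a ha
  have ha' : 0 < a := ha
  rcases hm.eq_or_lt with rfl | hm
  · constructor
    · unfold vlasovRho
      simp only [ne_eq, OfNat.ofNat_ne_zero, not_false_eq_true, zero_pow, zero_mul, zero_add]
      exact analyticAt_const
    · unfold vlasovP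
      simp only [ne_eq, OfNat.ofNat_ne_zero, not_false_eq_true, zero_pow, zero_mul, zero_add]
      exact analyticAt_const
  obtain ⟨r, hr⟩ := hFsupp.isCompact.isBounded.subset_closedBall 0
  have hM : ∀ n : ℕ, ∀ R, max 1 r < R → R ^ n * F (R^2) = 0 := by
    intro n R hR
    have h1 : 1 < R := (le_max_left _ _).trans_lt hR
    have h2 : r < R := (le_max_right _ _).trans_lt hR
    have : R^2 ∉ tsupport F := by
      intro h
      have := hr h
      rw [Metric.mem_closedBall, dist_zero_right, Real.norm_eq_abs, abs_of_nonneg (by positivity)] at this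
      nlinarith
    rw [image_eq_zero_of_notMem_tsupport this, mul_zero]
  have hq : AnalyticAt ℝ (fun a : ℝ => m^2 * a^2) a := by fun_prop
  have hpos : 0 < m^2 * a^2 := by positivity
  constructor
  · have h := vl_aux_an (1/2) (fun R => R^2 * F (R^2)) (by fun_prop) _ (hM 2) _ hpos
    refine ((analyticAt_const (v := 4 * π)).mul (AnalyticAt.fun_comp (f := fun a : ℝ => m^2 * a^2) (x := a) h hq)).congr (Eventually.of_forall fun b => ?_)
    simp only [vlasovRho, Pi.mul_apply, Function.comp, Real.sqrt_eq_rpow]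
    congr 2
    ext R
    ring
  · have h := vl_aux_an (-(1/2)) (fun R => R^4 * F (R^2)) (by fun_prop) _ (hM 4) _ hpos
    refine ((analyticAt_const (v := 4 * π / 3)).mul (AnalyticAt.fun_comp (f := fun a : ℝ => m^2 * a^2) (x := a) h hq)).congr (Eventually.of_forall fun b => ?_)
    simp only [vlasovP, Pi.mul_apply, Function.comp, Real.sqrt_eq_rpow]
    congr 2
    ext R
    rw [Real.rpow_neg (by positivity)]
    ring
end

section
/- For all a > 0 one has 0 ≤ ρ(a) − 3 p(a) ≤ 4π m a ∫₀^∞ R² 𝓕(R²) dR. Consequently, a ↦ ρ(a) is nondecreasing on (0,∞) and a ↦ a^{−2} ρ(a) is nonincreasing on (0,∞). -/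
open MeasureTheory Real Filter Topology Set

lemma vlasov_integrable (F : ℝ → ℝ) (hFcont : Continuous F) (hFsupp : HasCompactSupport F)
    (g : ℝ → ℝ) (hg : Continuous g) :
    IntegrableOn (fun R => g R * F (R ^ 2)) (Ioi (0 : ℝ)) := by
  apply Integrable.integrableOn
  apply Continuous.integrable_of_hasCompactSupport (by fun_prop)
  apply HasCompactSupport.mul_left
  obtain ⟨B, hB⟩ := hFsupp.isCompact.isBounded.subset_closedBall (0 : ℝ)
  refine HasCompactSupport.of_support_subset_isCompact (isCompact_Icc (a := -(B + 1)) (b := B + 1)) ?_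
  intro R hR
  have h1 : R ^ 2 ∈ tsupport F := subset_tsupport F hR
  have h2 := hB h1
  rw [Metric.mem_closedBall, dist_zero_right, Real.norm_eq_abs, abs_of_nonneg (sq_nonneg R)] at h2
  constructor <;> nlinarith [sq_nonneg (R - 1), sq_nonneg (R + 1)]

/-- for all `a > 0` one has
`0 ≤ ρ(a) − 3p(a) ≤ 4π m a ∫₀^∞ R² 𝓕(R²) dR`; consequently `ρ` is nondecreasing on
`(0,∞)` and `a ↦ a⁻² ρ(a)` is nonincreasing on `(0,∞)`. -/
theorem vlasov_equation_of_state_bounds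
    (m : ℝ) (hm : 0 ≤ m) (F : ℝ → ℝ)
    (hFcont : Continuous F) (hFsupp : HasCompactSupport F) (hFpos : ∀ x, 0 ≤ F x) :
    (∀ a ∈ Ioi (0 : ℝ),
      0 ≤ vlasovRho m F a - 3 * vlasovP m F a ∧
      vlasovRho m F a - 3 * vlasovP m F a ≤
        4 * π * m * a * ∫ R in Ioi (0 : ℝ), R ^ 2 * F (R ^ 2)) ∧
    MonotoneOn (vlasovRho m F) (Ioi (0 : ℝ)) ∧
    AntitoneOn (fun a => vlasovRho m F a / a ^ 2) (Ioi (0 : ℝ)) := by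
  have hI : ∀ a : ℝ, IntegrableOn
      (fun R => R ^ 2 * Real.sqrt (m ^ 2 * a ^ 2 + R ^ 2) * F (R ^ 2)) (Ioi (0 : ℝ)) := fun a =>
    vlasov_integrable F hFcont hFsupp (fun R => R ^ 2 * Real.sqrt (m ^ 2 * a ^ 2 + R ^ 2))
      (by fun_prop)
  have hI2 : IntegrableOn (fun R => R ^ 2 * F (R ^ 2)) (Ioi (0 : ℝ)) :=
    vlasov_integrable F hFcont hFsupp (fun R => R ^ 2) (by fun_prop)
  have hs : ∀ a R : ℝ, 0 < R → 0 < Real.sqrt (m ^ 2 * a ^ 2 + R ^ 2) := fun a R hR =>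
    Real.sqrt_pos.2 (by positivity)
  have hsq : ∀ a R : ℝ, Real.sqrt (m ^ 2 * a ^ 2 + R ^ 2) ^ 2 = m ^ 2 * a ^ 2 + R ^ 2 :=
    fun a R => Real.sq_sqrt (by positivity)
  have hle : ∀ a R : ℝ, 0 < R → R ^ 4 / Real.sqrt (m ^ 2 * a ^ 2 + R ^ 2) ≤
      R ^ 2 * Real.sqrt (m ^ 2 * a ^ 2 + R ^ 2) := by
    intro a R hR
    rw [div_le_iff₀ (hs a R hR), mul_assoc, ← pow_two, hsq]
    nlinarith [mul_nonneg (sq_nonneg R) (sq_nonneg (m * a))]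
  have hP : ∀ a : ℝ, IntegrableOn
      (fun R => R ^ 4 / Real.sqrt (m ^ 2 * a ^ 2 + R ^ 2) * F (R ^ 2)) (Ioi (0 : ℝ)) := by
    intro a
    refine Integrable.mono' (hI a) ?_ ?_
    · have := hFcont.measurable
      exact Measurable.aestronglyMeasurable (by fun_prop)
    · refine (ae_restrict_iff' measurableSet_Ioi).2 (Eventually.of_forall fun R hR => ?_)
      have := hFpos (R ^ 2)
      rw [Real.norm_eq_abs, abs_of_nonneg (by positivity)]
      exact mul_le_mul_of_nonneg_right (hle a R hR) this
  refine ⟨fun a ha => ?_, fun a ha b hb hab => ?_, fun a ha b hb hab => ?_⟩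
  · have ha' : 0 < a := ha
    have hd : vlasovRho m F a - 3 * vlasovP m F a = 4 * π * ∫ R in Ioi (0 : ℝ),
        (R ^ 2 * Real.sqrt (m ^ 2 * a ^ 2 + R ^ 2) * F (R ^ 2) -
          R ^ 4 / Real.sqrt (m ^ 2 * a ^ 2 + R ^ 2) * F (R ^ 2)) := by
      rw [integral_sub (hI a) (hP a), vlasovRho, vlasovP]
      ring
    rw [hd]
    constructor
    · have hpi : 0 ≤ 4 * π := by positivity
      refine mul_nonneg hpi (setIntegral_nonneg measurableSet_Ioi fun R hR => ?_)
      exact sub_nonneg.2 (mul_le_mul_of_nonneg_right (hle a R hR) (hFpos _))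
    · rw [mul_assoc (4 * π) m a, mul_assoc (4 * π) (m * a), ← integral_const_mul (m * a)]
      refine mul_le_mul_of_nonneg_left ?_ (show (0 : ℝ) ≤ 4 * π by positivity)
      refine setIntegral_mono_on ((hI a).sub (hP a)) (hI2.const_mul _) measurableSet_Ioi
        fun R hR => ?_
      have h0 := hs a R hR
      have h1 := hsq a R
      have h2 : m * a ≤ Real.sqrt (m ^ 2 * a ^ 2 + R ^ 2) :=
        Real.le_sqrt_of_sq_le (by nlinarith [sq_nonneg R])
      have h3 : 0 ≤ m * a := by positivity
      rw [← sub_mul, ← mul_assoc]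
      refine mul_le_mul_of_nonneg_right ?_ (hFpos _)
      rw [sub_le_iff_le_add, ← sub_le_iff_le_add', le_div_iff₀ h0]
      have h4 : m ^ 2 * a ^ 2 ≤ m * a * Real.sqrt (m ^ 2 * a ^ 2 + R ^ 2) := by nlinarith
      nlinarith [mul_le_mul_of_nonneg_left h4 (sq_nonneg R)]
  · have ha' : 0 < a := ha
    refine mul_le_mul_of_nonneg_left ?_ (show (0 : ℝ) ≤ 4 * π by positivity)
    refine setIntegral_mono_on (hI a) (hI b) measurableSet_Ioi fun R hR => ?_
    have := hFpos (R ^ 2)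
    gcongr
  · have ha' : 0 < a := ha
    have hb' : 0 < b := hb
    show vlasovRho m F b / b ^ 2 ≤ vlasovRho m F a / a ^ 2
    rw [div_le_div_iff₀ (by positivity) (by positivity), vlasovRho, vlasovRho, mul_assoc (4 * π), mul_assoc (4 * π),
      ← integral_mul_const, ← integral_mul_const]
    refine mul_le_mul_of_nonneg_left ?_ (show (0 : ℝ) ≤ 4 * π by positivity)
    refine setIntegral_mono_on ((hI b).mul_const _) ((hI a).mul_const _) measurableSet_Ioi
      fun R hR => ?_
    have h1 : a * Real.sqrt (m ^ 2 * b ^ 2 + R ^ 2) ≤ b * Real.sqrt (m ^ 2 * a ^ 2 + R ^ 2) := by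
      have := hs a R hR
      refine (sq_le_sq₀ (by positivity) (by positivity)).1 ?_
      rw [mul_pow, mul_pow, hsq, hsq]
      have : a ^ 2 * R ^ 2 ≤ b ^ 2 * R ^ 2 := by gcongr
      linarith
    have h2 : Real.sqrt (m ^ 2 * b ^ 2 + R ^ 2) * a ^ 2 ≤
        Real.sqrt (m ^ 2 * a ^ 2 + R ^ 2) * b ^ 2 := by
      have h3 := mul_le_mul_of_nonneg_left h1 ha'.le
      have h4 := mul_le_mul_of_nonneg_right hab (mul_nonneg hb'.le (hs a R hR).le)
      nlinarith
    have h5 := mul_le_mul_of_nonneg_left h2 (mul_nonneg (sq_nonneg R) (hFpos (R ^ 2)))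
    linarith
end

section
/- As a → 0⁺ one has ρ(a) → 4π ∫₀^∞ R³ 𝓕(R²) dR and p(a) → (4π/3) ∫₀^∞ R³ 𝓕(R²) dR; in particular ρ(a) − 3 p(a) → 0 as a → 0⁺, and in the massless case m = 0 one has ρ(a) = 3 p(a) for every a > 0 (radiation equation of state). -/
open MeasureTheory Real Filter Topology Set

/-- as `a → 0⁺`, `ρ(a) → 4π ∫₀^∞ R³ 𝓕(R²) dR` and
`p(a) → (4π/3) ∫₀^∞ R³ 𝓕(R²) dR`; in particular `ρ(a) − 3p(a) → 0` as `a → 0⁺`,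
and in the massless case `m = 0` one has `ρ(a) = 3 p(a)` for every `a > 0`. -/
theorem vlasov_radiation_limit
    (m : ℝ) (hm : 0 ≤ m) (F : ℝ → ℝ)
    (hFcont : Continuous F) (hFsupp : HasCompactSupport F) (hFpos : ∀ x, 0 ≤ F x) :
    Tendsto (vlasovRho m F) (𝓝[>] (0 : ℝ))
      (𝓝 (4 * π * ∫ R in Ioi (0 : ℝ), R ^ 3 * F (R ^ 2))) ∧
    Tendsto (vlasovP m F) (𝓝[>] (0 : ℝ))
      (𝓝 (4 * π / 3 * ∫ R in Ioi (0 : ℝ), R ^ 3 * F (R ^ 2))) ∧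
    Tendsto (fun a => vlasovRho m F a - 3 * vlasovP m F a) (𝓝[>] (0 : ℝ)) (𝓝 0) ∧
    (m = 0 → ∀ a : ℝ, 0 < a → vlasovRho m F a = 3 * vlasovP m F a) := by
  have hsupp : HasCompactSupport (fun R : ℝ => F (R ^ 2)) := by
    obtain ⟨B, hB⟩ := hFsupp.isCompact.isBounded.subset_closedBall (0 : ℝ)
    refine HasCompactSupport.intro (K := Icc (-(|B| + 1)) (|B| + 1)) isCompact_Icc ?_
    intro R hR
    by_contra hne
    apply hR
    have h1 : R ^ 2 ∈ Metric.closedBall (0 : ℝ) B := hB (subset_tsupport F hne)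
    rw [mem_closedBall_zero_iff, Real.norm_eq_abs, abs_of_nonneg (sq_nonneg R)] at h1
    have h2 := le_abs_self B
    constructor <;> nlinarith [abs_nonneg B]
  have hint : ∀ g : ℝ → ℝ, Continuous g →
      Integrable (fun R : ℝ => g R * F (R ^ 2)) (volume.restrict (Ioi (0 : ℝ))) := by
    intro g hg
    have hc : Continuous (fun R : ℝ => g R * F (R ^ 2)) := by fun_prop
    exact (hc.integrable_of_hasCompactSupport (hsupp.mul_left (f := g))).restrict
  have hlim : ∀ R : ℝ, 0 < R → Tendsto (fun a : ℝ => Real.sqrt (m ^ 2 * a ^ 2 + R ^ 2))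
      (𝓝[>] (0 : ℝ)) (𝓝 R) := by
    intro R hR
    have hc : Continuous (fun a : ℝ => Real.sqrt (m ^ 2 * a ^ 2 + R ^ 2)) := by fun_prop
    have := hc.tendsto 0
    simp only [ne_eq, OfNat.ofNat_ne_zero, not_false_eq_true, zero_pow, mul_zero, zero_add,
      Real.sqrt_sq hR.le] at this
    exact this.mono_left nhdsWithin_le_nhds
  have hrho : Tendsto (vlasovRho m F) (𝓝[>] (0 : ℝ))
      (𝓝 (4 * π * ∫ R in Ioi (0 : ℝ), R ^ 3 * F (R ^ 2))) := by
    unfold vlasovRho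
    apply Tendsto.const_mul
    refine tendsto_integral_filter_of_dominated_convergence
      (fun R => (R ^ 2 * Real.sqrt (m ^ 2 + R ^ 2)) * F (R ^ 2)) ?_ ?_ ?_ ?_
    · refine Eventually.of_forall fun a => ?_
      exact (hint (fun R => R ^ 2 * Real.sqrt (m ^ 2 * a ^ 2 + R ^ 2))
        (by fun_prop)).aestronglyMeasurable
    · have h1 : ∀ᶠ a : ℝ in 𝓝[>] (0 : ℝ), a ∈ Ioo (0 : ℝ) 1 := Ioo_mem_nhdsGT one_pos
      filter_upwards [h1] with a ha
      refine Eventually.of_forall fun R => ?_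
      have hF := hFpos (R ^ 2)
      rw [Real.norm_of_nonneg (by positivity)]
      have h3 : a ^ 2 ≤ 1 := by nlinarith [ha.1, ha.2]
      have h4 : m ^ 2 * a ^ 2 ≤ m ^ 2 := mul_le_of_le_one_right (sq_nonneg m) h3
      gcongr
    · exact hint _ (by fun_prop)
    · refine (ae_restrict_mem measurableSet_Ioi).mono fun R hR => ?_
      have h := ((hlim R hR).const_mul (R ^ 2)).mul_const (F (R ^ 2))
      have e : R ^ 2 * R = R ^ 3 := by ring
      rwa [e] at h
  have hp : Tendsto (vlasovP m F) (𝓝[>] (0 : ℝ))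
      (𝓝 (4 * π / 3 * ∫ R in Ioi (0 : ℝ), R ^ 3 * F (R ^ 2))) := by
    unfold vlasovP
    apply Tendsto.const_mul
    refine tendsto_integral_filter_of_dominated_convergence
      (fun R => R ^ 3 * F (R ^ 2)) ?_ ?_ ?_ ?_
    · refine Eventually.of_forall fun a => ?_
      have hm1 : Measurable F := hFcont.measurable
      exact Measurable.aestronglyMeasurable (by fun_prop)
    · refine Eventually.of_forall fun a => ?_
      refine (ae_restrict_mem measurableSet_Ioi).mono fun R hR => ?_
      have hR : 0 < R := hR
      have hF := hFpos (R ^ 2)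
      rw [Real.norm_of_nonneg (by positivity)]
      have h5 : R ≤ Real.sqrt (m ^ 2 * a ^ 2 + R ^ 2) :=
        Real.le_sqrt_of_sq_le (by nlinarith [sq_nonneg (m * a)])
      refine mul_le_mul_of_nonneg_right ?_ hF
      rw [div_le_iff₀ (lt_of_lt_of_le hR h5)]
      calc R ^ 4 = R ^ 3 * R := by ring
        _ ≤ _ := by gcongr
    · exact hint _ (by fun_prop)
    · refine (ae_restrict_mem measurableSet_Ioi).mono fun R hR => ?_
      have hR : 0 < R := hR
      have h := ((tendsto_const_nhds (x := R ^ 4)).div (hlim R hR) hR.ne').mul_const (F (R ^ 2))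
      have e : R ^ 4 / R = R ^ 3 := by field_simp
      rwa [e] at h
  refine ⟨hrho, hp, ?_, ?_⟩
  · have h := hrho.sub (hp.const_mul 3)
    convert h using 2
    ring
  · rintro rfl a _
    unfold vlasovRho vlasovP
    have e : ∫ R in Ioi (0 : ℝ), R ^ 2 * Real.sqrt (0 ^ 2 * a ^ 2 + R ^ 2) * F (R ^ 2)
        = ∫ R in Ioi (0 : ℝ), R ^ 4 / Real.sqrt (0 ^ 2 * a ^ 2 + R ^ 2) * F (R ^ 2) := by
      refine setIntegral_congr_fun measurableSet_Ioi fun R hR => ?_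
      have hR : 0 < R := hR
      have e0 : (0 : ℝ) ^ 2 * a ^ 2 + R ^ 2 = R ^ 2 := by ring
      simp only [e0, Real.sqrt_sq hR.le]
      field_simp
    rw [e]
    ring
end

section
/- Let C > 0 and define F(a) = (4π/3) C² a^{−4} + (8π/3) a^{−2} ρ(a) for a > 0. Then F is differentiable on (0,∞) with F'(a) = −(16π/3) C² a^{−5} − (8π/3) a^{−3} ( ρ(a) + 3 p(a) ) < 0, so F is strictly decreasing; moreover F(a) → +∞ as a → 0⁺ and F(a) → 0 as a → ∞. In particular, for every κ > 0 there exists a unique a_max > 0 with F(a_max) = κ. -/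
open MeasureTheory Real Filter Topology Set

/-- The right-hand side of the Friedman equation (without curvature):
`F(a) = (4π/3) C² a⁻⁴ + (8π/3) a⁻² ρ(a)`. -/
noncomputable def friedmannRHS (m : ℝ) (F : ℝ → ℝ) (C : ℝ) (a : ℝ) : ℝ :=
  4 * π / 3 * C ^ 2 / a ^ 4 + 8 * π / 3 * vlasovRho m F a / a ^ 2

lemma aux_int (F : ℝ → ℝ) (hFcont : Continuous F) (hFsupp : HasCompactSupport F)
    (g : ℝ → ℝ) (hg : Continuous g) :
    Integrable (fun R => g R * F (R ^ 2)) (volume.restrict (Ioi (0 : ℝ))) := by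
  have hc : HasCompactSupport (fun R : ℝ => F (R ^ 2)) := by
    obtain ⟨r, hr⟩ := hFsupp.isCompact.isBounded.subset_closedBall (0 : ℝ)
    refine HasCompactSupport.intro (isCompact_closedBall (0 : ℝ) (|r| + 1)) ?_
    intro x hx
    by_contra h
    have h1 := hr (subset_tsupport F h)
    simp only [Metric.mem_closedBall, dist_zero_right, Real.norm_eq_abs, not_le] at h1 hx
    rw [abs_of_nonneg (sq_nonneg x), ← sq_abs] at h1
    nlinarith [le_abs_self r, abs_nonneg r]
  have : Integrable (fun R => g R * F (R ^ 2)) volume :=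
    Continuous.integrable_of_hasCompactSupport (by fun_prop) hc.mul_left
  exact this.restrict

lemma aux_deriv (m : ℝ) (hm : 0 ≤ m) (F : ℝ → ℝ)
    (hFcont : Continuous F) (hFsupp : HasCompactSupport F) (hFpos : ∀ x, 0 ≤ F x) (a : ℝ) :
    Integrable (fun R : ℝ => R ^ 2 * (m ^ 2 * a / Real.sqrt (m ^ 2 * a ^ 2 + R ^ 2)) * F (R ^ 2))
      (volume.restrict (Ioi (0 : ℝ))) ∧
    HasDerivAt (fun x => ∫ R in Ioi (0 : ℝ), R ^ 2 * Real.sqrt (m ^ 2 * x ^ 2 + R ^ 2) * F (R ^ 2))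
      (∫ R in Ioi (0 : ℝ), R ^ 2 * (m ^ 2 * a / Real.sqrt (m ^ 2 * a ^ 2 + R ^ 2)) * F (R ^ 2)) a := by
  refine hasDerivAt_integral_of_dominated_loc_of_deriv_le
    (F := fun x R => R ^ 2 * Real.sqrt (m ^ 2 * x ^ 2 + R ^ 2) * F (R ^ 2))
    (F' := fun x R => R ^ 2 * (m ^ 2 * x / Real.sqrt (m ^ 2 * x ^ 2 + R ^ 2)) * F (R ^ 2))
    (bound := fun R => (R ^ 2 * m) * F (R ^ 2)) (s := univ) univ_mem ?_ ?_ ?_ ?_ ?_ ?_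
  · refine Eventually.of_forall fun x => ?_
    exact (aux_int F hFcont hFsupp _ (by fun_prop)).aestronglyMeasurable
  · exact aux_int F hFcont hFsupp (fun R => R ^ 2 * Real.sqrt (m ^ 2 * a ^ 2 + R ^ 2)) (by fun_prop)
  · have := hFcont.measurable
    exact Measurable.aestronglyMeasurable (by fun_prop)
  · refine (ae_restrict_mem measurableSet_Ioi).mono fun R hR x _ => ?_
    have hR : 0 < R := hR
    have hs : 0 < Real.sqrt (m ^ 2 * x ^ 2 + R ^ 2) := Real.sqrt_pos.2 (by positivity)
    have hle : m * |x| ≤ Real.sqrt (m ^ 2 * x ^ 2 + R ^ 2) := by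
      apply Real.le_sqrt_of_sq_le
      rw [mul_pow, sq_abs]
      nlinarith [sq_nonneg R]
    rw [norm_mul, norm_mul, Real.norm_of_nonneg (sq_nonneg R), Real.norm_of_nonneg (hFpos _)]
    refine mul_le_mul_of_nonneg_right ?_ (hFpos _)
    refine mul_le_mul_of_nonneg_left ?_ (sq_nonneg R)
    rw [Real.norm_eq_abs, abs_div, abs_mul, abs_of_pos hs, abs_of_nonneg (sq_nonneg m),
      div_le_iff₀ hs]
    nlinarith
  · exact aux_int F hFcont hFsupp (fun R => R ^ 2 * m) (by fun_prop)
  · refine (ae_restrict_mem measurableSet_Ioi).mono fun R hR x _ => ?_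
    have hR : 0 < R := hR
    have hp : 0 < m ^ 2 * x ^ 2 + R ^ 2 := by positivity
    have h1 : HasDerivAt (fun x : ℝ => m ^ 2 * x ^ 2 + R ^ 2) (m ^ 2 * (2 * x)) x := by
      have := ((hasDerivAt_pow 2 x).const_mul (m ^ 2)).add_const (R ^ 2)
      simpa using this
    have h2 := ((h1.sqrt hp.ne').const_mul (R ^ 2)).mul_const (F (R ^ 2))
    refine h2.congr_deriv ?_
    rw [show m ^ 2 * (2 * x) = 2 * (m ^ 2 * x) by ring, mul_div_mul_left _ _ two_ne_zero]

lemma aux_rho_nonneg (m : ℝ) (F : ℝ → ℝ) (hFpos : ∀ x, 0 ≤ F x) (a : ℝ) :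
    0 ≤ vlasovRho m F a := by
  unfold vlasovRho
  refine mul_nonneg (by positivity) (integral_nonneg fun R => ?_)
  exact mul_nonneg (by positivity) (hFpos _)

lemma aux_p_nonneg (m : ℝ) (F : ℝ → ℝ) (hFpos : ∀ x, 0 ≤ F x) (a : ℝ) :
    0 ≤ vlasovP m F a := by
  unfold vlasovP
  refine mul_nonneg (by positivity) (integral_nonneg fun R => ?_)
  exact mul_nonneg (by positivity) (hFpos _)

lemma aux_rho_deriv (m : ℝ) (hm : 0 ≤ m) (F : ℝ → ℝ)
    (hFcont : Continuous F) (hFsupp : HasCompactSupport F) (hFpos : ∀ x, 0 ≤ F x) (a : ℝ) :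
    ∃ d, HasDerivAt (vlasovRho m F) d a ∧ a * d = vlasovRho m F a - 3 * vlasovP m F a := by
  obtain ⟨hi, hd⟩ := aux_deriv m hm F hFcont hFsupp hFpos a
  refine ⟨_, hd.const_mul (4 * π), ?_⟩
  have hI := aux_int F hFcont hFsupp (fun R => R ^ 2 * Real.sqrt (m ^ 2 * a ^ 2 + R ^ 2))
    (by fun_prop)
  have key : (∫ R in Ioi (0 : ℝ), R ^ 4 / Real.sqrt (m ^ 2 * a ^ 2 + R ^ 2) * F (R ^ 2)) =
      (∫ R in Ioi (0 : ℝ), R ^ 2 * Real.sqrt (m ^ 2 * a ^ 2 + R ^ 2) * F (R ^ 2)) -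
      a * ∫ R in Ioi (0 : ℝ),
        R ^ 2 * (m ^ 2 * a / Real.sqrt (m ^ 2 * a ^ 2 + R ^ 2)) * F (R ^ 2) := by
    rw [← integral_const_mul, ← integral_sub hI (hi.const_mul a)]
    refine setIntegral_congr_fun measurableSet_Ioi fun R hR => ?_
    have hR : 0 < R := hR
    have hp : 0 < m ^ 2 * a ^ 2 + R ^ 2 := by positivity
    have hs := (Real.sqrt_pos.2 hp).ne'
    have hsq := Real.sq_sqrt hp.le
    field_simp
    rw [hsq]
    ring
  unfold vlasovRho vlasovP
  rw [key]
  ring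

lemma aux_rho_le (m : ℝ) (hm : 0 ≤ m) (F : ℝ → ℝ)
    (hFcont : Continuous F) (hFsupp : HasCompactSupport F) (hFpos : ∀ x, 0 ≤ F x) :
    ∃ A B : ℝ, ∀ a, 0 < a → vlasovRho m F a ≤ A * a + B := by
  refine ⟨4 * π * ∫ R in Ioi (0 : ℝ), (R ^ 2 * m) * F (R ^ 2),
    4 * π * ∫ R in Ioi (0 : ℝ), (R ^ 3) * F (R ^ 2), fun a ha => ?_⟩
  have h1 := aux_int F hFcont hFsupp (fun R => R ^ 2 * m) (by fun_prop)
  have h2 := aux_int F hFcont hFsupp (fun R => R ^ 3) (by fun_prop)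
  have hI := aux_int F hFcont hFsupp (fun R => R ^ 2 * Real.sqrt (m ^ 2 * a ^ 2 + R ^ 2))
    (by fun_prop)
  have h : (∫ R in Ioi (0 : ℝ), R ^ 2 * Real.sqrt (m ^ 2 * a ^ 2 + R ^ 2) * F (R ^ 2)) ≤
      a * (∫ R in Ioi (0 : ℝ), (R ^ 2 * m) * F (R ^ 2)) +
        ∫ R in Ioi (0 : ℝ), (R ^ 3) * F (R ^ 2) := by
    rw [← integral_const_mul, ← integral_add (h1.const_mul a) h2]
    refine setIntegral_mono_on hI ((h1.const_mul a).add h2) measurableSet_Ioi fun R hR => ?_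
    have hR : 0 < R := hR
    have hle : Real.sqrt (m ^ 2 * a ^ 2 + R ^ 2) ≤ m * a + R := by
      refine Real.sqrt_le_iff.2 ⟨by positivity, ?_⟩
      have : 0 ≤ m * a * R := by positivity
      nlinarith
    have := mul_le_mul_of_nonneg_right (mul_le_mul_of_nonneg_left hle (sq_nonneg R)) (hFpos (R ^ 2))
    refine this.trans (le_of_eq ?_)
    ring
  unfold vlasovRho
  have := mul_le_mul_of_nonneg_left h (show 0 ≤ 4 * π by positivity)
  linarith

/-- `F(a) = (4π/3)C²a⁻⁴ + (8π/3)a⁻²ρ(a)` is differentiable on `(0,∞)` with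
`F'(a) = −(16π/3)C²a⁻⁵ − (8π/3)a⁻³(ρ(a)+3p(a)) < 0`, hence strictly decreasing;
moreover `F(a) → +∞` as `a → 0⁺` and `F(a) → 0` as `a → ∞`, so for every `κ > 0`
there is a unique `a_max > 0` with `F(a_max) = κ`. -/
theorem friedmannRHS_strictAnti
    (m : ℝ) (hm : 0 ≤ m) (F : ℝ → ℝ)
    (hFcont : Continuous F) (hFsupp : HasCompactSupport F) (hFpos : ∀ x, 0 ≤ F x)
    (C : ℝ) (hC : 0 < C) :
    (∀ a ∈ Ioi (0 : ℝ),
      HasDerivAt (friedmannRHS m F C)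
        (-(16 * π / 3) * C ^ 2 / a ^ 5
          - 8 * π / 3 * (vlasovRho m F a + 3 * vlasovP m F a) / a ^ 3) a ∧
      -(16 * π / 3) * C ^ 2 / a ^ 5
          - 8 * π / 3 * (vlasovRho m F a + 3 * vlasovP m F a) / a ^ 3 < 0) ∧
    StrictAntiOn (friedmannRHS m F C) (Ioi (0 : ℝ)) ∧
    Tendsto (friedmannRHS m F C) (𝓝[>] (0 : ℝ)) atTop ∧
    Tendsto (friedmannRHS m F C) atTop (𝓝 0) ∧
    (∀ κ : ℝ, 0 < κ → ∃! a : ℝ, 0 < a ∧ friedmannRHS m F C a = κ) := by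
  have hder : ∀ a ∈ Ioi (0 : ℝ),
      HasDerivAt (friedmannRHS m F C)
        (-(16 * π / 3) * C ^ 2 / a ^ 5
          - 8 * π / 3 * (vlasovRho m F a + 3 * vlasovP m F a) / a ^ 3) a ∧
      -(16 * π / 3) * C ^ 2 / a ^ 5
          - 8 * π / 3 * (vlasovRho m F a + 3 * vlasovP m F a) / a ^ 3 < 0 := by
    intro a ha
    have ha : 0 < a := ha
    constructor
    · obtain ⟨d, hd, had⟩ := aux_rho_deriv m hm F hFcont hFsupp hFpos a
      have h1 := (hasDerivAt_const a (4 * π / 3 * C ^ 2)).div (hasDerivAt_pow 4 a) (by positivity)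
      have h2 := (hd.const_mul (8 * π / 3)).div (hasDerivAt_pow 2 a) (by positivity)
      have h3 := h1.add h2
      have hp : 3 * vlasovP m F a = vlasovRho m F a - a * d := by linarith
      rw [hp]
      refine HasDerivAt.congr_deriv (f := friedmannRHS m F C) h3 ?_
      field_simp
      push_cast
      ring
    · have h1 := aux_rho_nonneg m F hFpos a
      have h2 := aux_p_nonneg m F hFpos a
      have h3 : 0 < (16 * π / 3) * C ^ 2 / a ^ 5 := by positivity
      have h4 : 0 ≤ 8 * π / 3 * (vlasovRho m F a + 3 * vlasovP m F a) / a ^ 3 := by positivity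
      have h5 : -(16 * π / 3) * C ^ 2 / a ^ 5 = -((16 * π / 3) * C ^ 2 / a ^ 5) := by ring
      rw [h5]
      linarith
  have hcont : ContinuousOn (friedmannRHS m F C) (Ioi (0 : ℝ)) :=
    fun a ha => (hder a ha).1.continuousAt.continuousWithinAt
  have hanti : StrictAntiOn (friedmannRHS m F C) (Ioi (0 : ℝ)) := by
    refine strictAntiOn_of_deriv_neg (convex_Ioi 0) hcont fun a ha => ?_
    rw [interior_Ioi] at ha
    rw [(hder a ha).1.deriv]
    exact (hder a ha).2
  have h0 : Tendsto (friedmannRHS m F C) (𝓝[>] (0 : ℝ)) atTop := by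
    have h1 : Tendsto (fun a : ℝ => 4 * π / 3 * C ^ 2 * (a⁻¹) ^ 4) (𝓝[>] (0 : ℝ)) atTop :=
      Tendsto.const_mul_atTop (by positivity)
        ((tendsto_pow_atTop (by norm_num)).comp tendsto_inv_nhdsGT_zero)
    refine tendsto_atTop_mono (fun a => ?_) h1
    have h2 := aux_rho_nonneg m F hFpos a
    have h3 : 0 ≤ 8 * π / 3 * vlasovRho m F a / a ^ 2 := by positivity
    unfold friedmannRHS
    rw [inv_pow, ← div_eq_mul_inv]
    linarith
  have hinf : Tendsto (friedmannRHS m F C) atTop (𝓝 0) := by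
    obtain ⟨A, B, hAB⟩ := aux_rho_le m hm F hFcont hFsupp hFpos
    have hi : Tendsto (fun a : ℝ => a⁻¹) atTop (𝓝 0) := tendsto_inv_atTop_zero
    have hu : Tendsto (fun a : ℝ => 4 * π / 3 * C ^ 2 * (a⁻¹) ^ 4 +
        8 * π / 3 * (A * a⁻¹ + B * (a⁻¹) ^ 2)) atTop (𝓝 0) := by
      have := ((hi.pow 4).const_mul (4 * π / 3 * C ^ 2)).add
        (((hi.const_mul A).add ((hi.pow 2).const_mul B)).const_mul (8 * π / 3))
      simpa using this
    refine tendsto_of_tendsto_of_tendsto_of_le_of_le' tendsto_const_nhds hu ?_ ?_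
    · filter_upwards [eventually_gt_atTop (0 : ℝ)] with a ha
      have h2 := aux_rho_nonneg m F hFpos a
      unfold friedmannRHS
      positivity
    · filter_upwards [eventually_gt_atTop (0 : ℝ)] with a ha
      have h2 : 8 * π / 3 * vlasovRho m F a / a ^ 2 ≤ 8 * π / 3 * (A * a + B) / a ^ 2 := by
        gcongr
        exact hAB a ha
      unfold friedmannRHS
      have h3 : 8 * π / 3 * (A * a + B) / a ^ 2 = 8 * π / 3 * (A * a⁻¹ + B * (a⁻¹) ^ 2) := by
        field_simp
      rw [← h3, inv_pow, ← div_eq_mul_inv]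
      linarith
  refine ⟨hder, hanti, h0, hinf, fun κ hκ => ?_⟩
  obtain ⟨x, hx, hxp⟩ := ((h0.eventually_ge_atTop κ).and self_mem_nhdsWithin).exists
  obtain ⟨y, hy, hyx⟩ := ((hinf.eventually_lt_const hκ).and (eventually_ge_atTop x)).exists
  have hxp : 0 < x := hxp
  obtain ⟨z, hz, hzκ⟩ := intermediate_value_Icc' hyx
    (hcont.mono fun t ht => lt_of_lt_of_le hxp ht.1) ⟨hy.le, hx⟩
  have hz0 : 0 < z := lt_of_lt_of_le hxp hz.1
  refine ⟨z, ⟨hz0, hzκ⟩, fun w hw => ?_⟩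
  exact hanti.injOn hw.1 hz0 (hw.2.trans hzκ.symm)
end

section
/- Let C > 0, κ ≤ 0, m ≥ 0 and 𝓕 : [0,∞) → [0,∞) continuous with compact support. Then there exists a function a : [0,∞) → [0,∞) which is continuous with a(0) = 0, positive and strictly increasing on (0,∞), real-analytic on (0,∞), and satisfies ȧ(t) = √( (4π/3) C² a(t)^{−4} + (8π/3) a(t)^{−2} ρ(a(t)) − κ ) for all t > 0; in particular the scale factor exists globally in time (T = ∞). -/
open MeasureTheory Real Filter Topology Set

lemma fr_supp {F : ℝ → ℝ} (hFsupp : HasCompactSupport F) :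
    ∃ B : ℝ, 0 < B ∧ ∀ R, R ∉ Icc (-B) B → F (R ^ 2) = 0 := by
  obtain ⟨B, hB⟩ := hFsupp.isCompact.isBounded.subset_closedBall 0
  refine ⟨|B| + 1, by positivity, fun R hR => ?_⟩
  by_contra h
  have h1 : R ^ 2 ∈ Metric.closedBall (0 : ℝ) B := hB (subset_tsupport _ h)
  rw [Metric.mem_closedBall, dist_zero_right, Real.norm_eq_abs, abs_of_nonneg (sq_nonneg R)] at h1
  apply hR
  rw [mem_Icc, ← abs_le]
  have h2 := le_abs_self B
  have h3 := sq_abs R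
  nlinarith [abs_nonneg R, abs_nonneg B]

lemma fr_int {F : ℝ → ℝ} (hFcont : Continuous F) (hFsupp : HasCompactSupport F)
    {g : ℝ → ℝ} (hg : Continuous g) : Integrable (fun R => R ^ 2 * g R * F (R ^ 2)) := by
  obtain ⟨B, hB, h⟩ := fr_supp hFsupp
  refine Continuous.integrable_of_hasCompactSupport (by fun_prop) ?_
  refine HasCompactSupport.intro (isCompact_Icc (a := -B) (b := B)) fun R hR => ?_
  simp [h R hR]

lemma fr_rho_cont (m : ℝ) {F : ℝ → ℝ} (hFcont : Continuous F) (hFsupp : HasCompactSupport F) :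
    Continuous (vlasovRho m F) := by
  obtain ⟨B, hB, h⟩ := fr_supp hFsupp
  have : vlasovRho m F = fun a => 4 * π * ∫ R in Icc 0 B,
      R ^ 2 * Real.sqrt (m ^ 2 * a ^ 2 + R ^ 2) * F (R ^ 2) := by
    funext a
    unfold vlasovRho
    congr 1
    rw [integral_Icc_eq_integral_Ioc]
    refine setIntegral_eq_of_subset_of_forall_sdiff_eq_zero measurableSet_Ioi
      Ioc_subset_Ioi_self (fun R hR => ?_)
    rw [h R, mul_zero]
    intro h'
    exact hR.2 ⟨hR.1, h'.2⟩
  rw [this]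
  refine continuous_const.mul (continuous_parametric_integral_of_continuous
    (f := fun a R => R ^ 2 * Real.sqrt (m ^ 2 * a ^ 2 + R ^ 2) * F (R ^ 2)) ?_ isCompact_Icc)
  simp only [Function.uncurry_def]
  fun_prop

lemma fr_rho_nonneg (m : ℝ) {F : ℝ → ℝ} (hFpos : ∀ x, 0 ≤ F x) (a : ℝ) :
    0 ≤ vlasovRho m F a := by
  unfold vlasovRho
  have : 0 ≤ ∫ R in Ioi (0 : ℝ), R ^ 2 * Real.sqrt (m ^ 2 * a ^ 2 + R ^ 2) * F (R ^ 2) :=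
    integral_nonneg fun R => mul_nonneg (by positivity) (hFpos _)
  positivity

lemma fr_rho_growth (m : ℝ) {F : ℝ → ℝ} (hFcont : Continuous F) (hFsupp : HasCompactSupport F)
    (hFpos : ∀ x, 0 ≤ F x) (a : ℝ) (ha : 1 ≤ a) :
    vlasovRho m F a ≤ a * vlasovRho m F 1 := by
  unfold vlasovRho
  rw [mul_left_comm]
  refine mul_le_mul_of_nonneg_left ?_ (by positivity)
  rw [← integral_const_mul]
  refine integral_mono (fr_int hFcont hFsupp (by fun_prop)).integrableOn
    ((fr_int hFcont hFsupp (by fun_prop)).integrableOn.const_mul a) fun R => ?_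
  have : √(m ^ 2 * a ^ 2 + R ^ 2) ≤ a * √(m ^ 2 * 1 ^ 2 + R ^ 2) := by
    rw [Real.sqrt_le_left (by positivity), mul_pow, Real.sq_sqrt (by positivity)]
    have h1 : 1 * R ^ 2 ≤ a ^ 2 * R ^ 2 :=
      mul_le_mul_of_nonneg_right (one_le_pow₀ ha) (sq_nonneg R)
    nlinarith
  calc _ = (R ^ 2 * F (R ^ 2)) * √(m ^ 2 * a ^ 2 + R ^ 2) := by ring
    _ ≤ (R ^ 2 * F (R ^ 2)) * (a * √(m ^ 2 * 1 ^ 2 + R ^ 2)) :=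
        mul_le_mul_of_nonneg_left this (mul_nonneg (sq_nonneg _) (hFpos _))
    _ = _ := by ring

noncomputable def rhoC (m : ℝ) (F : ℝ → ℝ) (z : ℂ) : ℂ :=
  4 * π * ∫ R in Ioi (0 : ℝ),
    ((R ^ 2 * F (R ^ 2) : ℝ) : ℂ) * ((m : ℂ) ^ 2 * z ^ 2 + (R : ℂ) ^ 2) ^ (((1 / 2 : ℝ)) : ℂ)

lemma rhoC_ofReal (m : ℝ) (F : ℝ → ℝ) (a : ℝ) : rhoC m F a = (vlasovRho m F a : ℂ) := by
  unfold rhoC vlasovRho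
  rw [Complex.ofReal_mul, ← integral_complex_ofReal]
  congr 1
  · push_cast; rfl
  refine integral_congr_ae (ae_of_all _ fun R => ?_)
  have : ((m : ℂ) ^ 2 * (a : ℂ) ^ 2 + (R : ℂ) ^ 2) ^ (((1 / 2 : ℝ)) : ℂ)
      = ((√(m ^ 2 * a ^ 2 + R ^ 2) : ℝ) : ℂ) := by
    rw [Real.sqrt_eq_rpow, Complex.ofReal_cpow (by positivity)]
    push_cast
    rfl
  beta_reduce
  rw [this]
  push_cast
  ring

lemma fr_slit {m : ℝ} (hm : 0 < m) {z : ℂ} (hz : 0 < z.re) (R : ℝ) :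
    (m : ℂ) ^ 2 * z ^ 2 + (R : ℂ) ^ 2 ∈ Complex.slitPlane := by
  rw [Complex.mem_slitPlane_iff]
  have hre : ((m : ℂ) ^ 2 * z ^ 2 + (R : ℂ) ^ 2).re = m ^ 2 * (z.re ^ 2 - z.im ^ 2) + R ^ 2 := by
    simp [pow_two]
  have him : ((m : ℂ) ^ 2 * z ^ 2 + (R : ℂ) ^ 2).im = m ^ 2 * (2 * z.re * z.im) := by
    simp [pow_two]; left; ring
  rw [hre, him]
  by_cases h : z.im = 0
  · left; rw [h]; have : 0 < m ^ 2 * (z.re ^ 2 - 0 ^ 2) := by ring_nf; positivity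
    positivity
  · right; positivity

lemma fr_norm {m : ℝ} {z : ℂ} (R : ℝ) :
    m ^ 2 * z.re ^ 2 ≤ ‖(m : ℂ) ^ 2 * z ^ 2 + (R : ℂ) ^ 2‖ := by
  have : (m : ℂ) ^ 2 * z ^ 2 + (R : ℂ) ^ 2 = (m * z + R * Complex.I) * (m * z - R * Complex.I) := by
    ring_nf; simp
  rw [this, norm_mul]
  have h1 : |m * z.re| ≤ ‖m * z + R * Complex.I‖ := by
    have := Complex.abs_re_le_norm (m * z + R * Complex.I); simpa using this
  have h2 : |m * z.re| ≤ ‖m * z - R * Complex.I‖ := by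
    have := Complex.abs_re_le_norm (m * z - R * Complex.I); simpa using this
  calc m ^ 2 * z.re ^ 2 = |m * z.re| * |m * z.re| := by rw [abs_mul_abs_self]; ring
    _ ≤ _ := mul_le_mul h1 h2 (abs_nonneg _) (norm_nonneg _)

lemma rhoC_diff {m : ℝ} (hm : 0 ≤ m) {F : ℝ → ℝ} (hFcont : Continuous F)
    (hFsupp : HasCompactSupport F) (hFpos : ∀ x, 0 ≤ F x) (z₀ : ℂ) (hz : 0 < z₀.re) :
    DifferentiableAt ℂ (rhoC m F) z₀ := by
  unfold rhoC
  rcases hm.eq_or_lt with rfl | hm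
  · simp
  refine DifferentiableAt.const_mul ?_ _
  set s : Set ℂ := {z | z₀.re / 2 < z.re ∧ ‖z‖ < ‖z₀‖ + 1} with hs
  have hso : IsOpen s :=
    (isOpen_lt continuous_const Complex.continuous_re).inter
      (isOpen_lt continuous_norm continuous_const)
  have hmem : s ∈ 𝓝 z₀ := hso.mem_nhds ⟨by linarith, by linarith⟩
  have hFm : Measurable F := hFcont.measurable
  set K : ℝ := 1 / 2 * (m ^ 2 * (z₀.re / 2) ^ 2) ^ ((1 / 2 : ℝ) - 1) * (m ^ 2 * (2 * (‖z₀‖ + 1)))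
    with hK
  have key := hasDerivAt_integral_of_dominated_loc_of_deriv_le (μ := volume.restrict (Ioi (0 : ℝ)))
    (F := fun (z : ℂ) (R : ℝ) => ((R ^ 2 * F (R ^ 2) : ℝ) : ℂ) *
      ((m : ℂ) ^ 2 * z ^ 2 + (R : ℂ) ^ 2) ^ (((1 / 2 : ℝ)) : ℂ))
    (F' := fun (z : ℂ) (R : ℝ) => ((R ^ 2 * F (R ^ 2) : ℝ) : ℂ) *
      ((((1 / 2 : ℝ)) : ℂ) * ((m : ℂ) ^ 2 * z ^ 2 + (R : ℂ) ^ 2) ^ ((((1 / 2 : ℝ)) : ℂ) - 1)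
        * ((m : ℂ) ^ 2 * (2 * z))))
    (bound := fun R => R ^ 2 * K * F (R ^ 2)) (x₀ := z₀) (s := s) hmem ?_ ?_ ?_ ?_ ?_ ?_
  · exact key.2.differentiableAt
  · refine Eventually.of_forall fun z => Measurable.aestronglyMeasurable ?_
    fun_prop
  · have hb := (fr_int hFcont hFsupp (g := fun R => (m ^ 2 * ‖z₀‖ ^ 2 + R ^ 2) ^ (1 / 2 : ℝ))
      (by
        refine Continuous.rpow_const (by fun_prop) ?_
        intro x; right; norm_num)).integrableOn (s := Ioi (0 : ℝ))
    refine Integrable.mono' hb (Measurable.aestronglyMeasurable (by fun_prop)) ?_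
    refine ae_of_all _ fun R => ?_
    rw [norm_mul, Complex.norm_cpow_real, Complex.norm_real,
      Real.norm_of_nonneg (mul_nonneg (sq_nonneg _) (hFpos _)), mul_right_comm]
    refine mul_le_mul_of_nonneg_right ?_ (hFpos _)
    refine mul_le_mul_of_nonneg_left ?_ (sq_nonneg _)
    refine Real.rpow_le_rpow (norm_nonneg _) ?_ (by norm_num)
    refine (norm_add_le _ _).trans (le_of_eq ?_)
    simp
  · refine Measurable.aestronglyMeasurable ?_
    fun_prop
  · refine ae_of_all _ fun R z hzs => ?_
    have e : ((((1 / 2 : ℝ)) : ℂ) - 1) = (((1 / 2 : ℝ) - 1 : ℝ) : ℂ) := by push_cast; ring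
    rw [e, norm_mul, norm_mul, norm_mul, Complex.norm_cpow_real, Complex.norm_real, Complex.norm_real,
      Real.norm_of_nonneg (mul_nonneg (sq_nonneg _) (hFpos _)), mul_right_comm]
    rw [Real.norm_of_nonneg (by norm_num : (0 : ℝ) ≤ 1 / 2)]
    refine mul_le_mul_of_nonneg_right ?_ (hFpos _)
    refine mul_le_mul_of_nonneg_left ?_ (sq_nonneg _)
    rw [hK]
    have hp : (0 : ℝ) < m ^ 2 * (z₀.re / 2) ^ 2 := by positivity
    refine mul_le_mul (mul_le_mul_of_nonneg_left ?_ (by norm_num)) ?_ (norm_nonneg _) (by positivity)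
    · refine Real.rpow_le_rpow_of_nonpos hp ?_ (by norm_num)
      refine le_trans ?_ (fr_norm R)
      have := hzs.1
      gcongr
    · simp only [norm_mul, norm_pow, Complex.norm_real, Real.norm_of_nonneg hm.le, Complex.norm_ofNat]
      have := hzs.2.le
      gcongr
  · exact (fr_int hFcont hFsupp (g := fun _ => K) (by fun_prop)).integrableOn
  · refine ae_of_all _ fun R z hzs => ?_
    have hz' : 0 < z.re := by have := hzs.1; linarith
    refine HasDerivAt.const_mul _ ?_
    have h1 : HasDerivAt (fun z : ℂ => (m : ℂ) ^ 2 * z ^ 2 + (R : ℂ) ^ 2) ((m : ℂ) ^ 2 * (2 * z)) z := by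
      have := ((hasDerivAt_pow 2 z).const_mul ((m : ℂ) ^ 2)).add_const ((R : ℂ) ^ 2)
      simpa using this
    exact h1.cpow_const (fr_slit hm hz' R)

lemma fr_primitive {T : ℝ → ℝ} {g : ℂ → ℂ} {x : ℝ} (hg : AnalyticAt ℂ g x)
    (hT : ∀ᶠ y : ℝ in 𝓝 x, HasDerivAt T (g y).re y) : AnalyticAt ℝ T x := by
  obtain ⟨r, hr, hball⟩ := Metric.eventually_nhds_iff_ball.1 hg.eventually_analyticAt
  obtain ⟨r', hr', hball'⟩ := Metric.eventually_nhds_iff_ball.1 hT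
  obtain ⟨G, hG⟩ := DifferentiableOn.isExactOn_ball (c := (x : ℂ)) (r := r) (f := g)
    fun z hz => (hball z hz).differentiableAt.differentiableWithinAt
  have hGa : AnalyticAt ℂ G x := by
    refine DifferentiableOn.analyticAt (s := Metric.ball (x : ℂ) r)
      (fun z hz => (hG z hz).differentiableAt.differentiableWithinAt)
      (Metric.ball_mem_nhds _ hr)
  have hH : AnalyticAt ℝ (fun y : ℝ => (G y).re) x := by
    have h1 : AnalyticAt ℝ G (x : ℂ) := hGa.restrictScalars
    have h2 : AnalyticAt ℝ (fun y : ℝ => (y : ℂ)) x := Complex.ofRealCLM.analyticAt x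
    exact (Complex.reCLM.analyticAt _).comp (h1.comp h2)
  set δ := min r r'
  have hδ : 0 < δ := lt_min hr hr'
  have hd : ∀ y ∈ Metric.ball x δ, HasDerivAt (fun y => T y - (G y).re) 0 y := by
    intro y hy
    have hy1 : (y : ℂ) ∈ Metric.ball (x : ℂ) r := by
      rw [Metric.mem_ball, Complex.dist_eq, ← Complex.ofReal_sub, Complex.norm_real]
      exact lt_of_lt_of_le hy (min_le_left _ _)
    have h1 := hball' y (Metric.ball_subset_ball (min_le_right _ _) hy)
    have h2 := (hG y hy1).real_of_complex
    have h3 := h1.sub h2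
    rw [sub_self] at h3
    exact h3
  have hc : ∀ y ∈ Metric.ball x δ, T y - (G y).re = T x - (G x).re := by
    intro y hy
    refine (convex_ball x δ).is_const_of_fderivWithin_eq_zero (𝕜 := ℝ)
      (f := fun y : ℝ => T y - (G y).re)
      (fun z hz => (hd z hz).differentiableAt.differentiableWithinAt) (fun z hz => ?_) hy
      (Metric.mem_ball_self hδ)
    rw [fderivWithin_of_isOpen Metric.isOpen_ball hz]
    have := (hd z hz).hasFDerivAt.fderiv
    rw [this]; ext; simp
  refine (hH.add (analyticAt_const (v := T x - (G x).re))).congr ?_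
  filter_upwards [Metric.ball_mem_nhds x hδ] with y hy
  have := hc y hy
  simp only [Pi.add_apply]
  linarith

noncomputable def frD (m : ℝ) (F : ℝ → ℝ) (C κ : ℝ) (a : ℝ) : ℝ :=
  4 * π / 3 * C ^ 2 + 8 * π / 3 * vlasovRho m F a * a ^ 2 - κ * a ^ 4

noncomputable def frh (m : ℝ) (F : ℝ → ℝ) (C κ : ℝ) (a : ℝ) : ℝ :=
  a ^ 2 / √(frD m F C κ a)

theorem friedmann_global_existence
    (m : ℝ) (hm : 0 ≤ m) (F : ℝ → ℝ)
    (hFcont : Continuous F) (hFsupp : HasCompactSupport F) (hFpos : ∀ x, 0 ≤ F x)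
    (C : ℝ) (hC : 0 < C) (κ : ℝ) (hκ : κ ≤ 0) :
    ∃ a : ℝ → ℝ,
      ContinuousOn a (Ici (0 : ℝ)) ∧
      a 0 = 0 ∧
      (∀ t ∈ Ioi (0 : ℝ), 0 < a t) ∧
      StrictMonoOn a (Ioi (0 : ℝ)) ∧
      (∀ t ∈ Ioi (0 : ℝ), AnalyticAt ℝ a t) ∧
      (∀ t ∈ Ioi (0 : ℝ), HasDerivAt a
        (Real.sqrt (4 * π / 3 * C ^ 2 / (a t) ^ 4
          + 8 * π / 3 * vlasovRho m F (a t) / (a t) ^ 2 - κ)) t) := by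
  have hρ := fr_rho_cont m hFcont hFsupp
  have hρ0 := fr_rho_nonneg m hFpos
  set D := frD m F C κ with hD
  set h := frh m F C κ with hh
  have hDpos : ∀ a, 0 < D a := by
    intro a
    have h1 := hρ0 a
    have h2 : 0 ≤ (-κ) * a ^ 4 := mul_nonneg (by linarith) (by positivity)
    have h3 : 0 < 4 * π / 3 * C ^ 2 := by positivity
    have h4 : 0 ≤ 8 * π / 3 * vlasovRho m F a * a ^ 2 := by positivity
    simp only [hD, frD]
    linarith
  have hDc : Continuous D := by
    rw [hD]; unfold frD; fun_prop
  have hhc : Continuous h := by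
    rw [hh]; unfold frh
    exact (continuous_pow 2).div (hDc.sqrt) fun a => (Real.sqrt_pos.2 (hDpos a)).ne'
  have hh0 : ∀ a, 0 ≤ h a := fun a => by rw [hh]; unfold frh; positivity
  have hhpos : ∀ a, a ≠ 0 → 0 < h a := fun a ha => by
    have := Real.sqrt_pos.2 (hDpos a)
    rw [hh]; unfold frh; rw [← hD]; positivity
  have hheven : ∀ a, h (-a) = h a := fun a => by
    have : vlasovRho m F (-a) = vlasovRho m F a := by unfold vlasovRho; simp
    simp only [hh, frh, frD, this]
    congr 1
    · ring
    · congr 1; ring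
  have hhbig : ∀ a, 1 ≤ a → h 1 ≤ h a := by
    intro a ha
    have h1 := fr_rho_growth m hFcont hFsupp hFpos a ha
    have h2 : D a ≤ (a ^ 2) ^ 2 * D 1 := by
      have h3 : vlasovRho m F a ≤ a ^ 2 * vlasovRho m F 1 :=
        h1.trans (mul_le_mul_of_nonneg_right (by nlinarith) (hρ0 1))
      have h4 : 8 * π / 3 * vlasovRho m F a * a ^ 2
          ≤ 8 * π / 3 * (a ^ 2 * vlasovRho m F 1) * a ^ 2 := by gcongr
      have h5 : 4 * π / 3 * C ^ 2 * 1 ≤ 4 * π / 3 * C ^ 2 * a ^ 4 := by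
        gcongr
        exact one_le_pow₀ ha
      simp only [hD, frD]
      nlinarith
    have h3 : √(D a) ≤ a ^ 2 * √(D 1) := by
      rw [Real.sqrt_le_left (by positivity), mul_pow, Real.sq_sqrt (hDpos 1).le]
      exact h2
    simp only [hh, frh]
    rw [← hD, div_le_div_iff₀ (Real.sqrt_pos.2 (hDpos _)) (Real.sqrt_pos.2 (hDpos _))]
    linarith
  set T : ℝ → ℝ := fun a => ∫ x in (0 : ℝ)..a, h x with hT
  have hint : ∀ a b, IntervalIntegrable h volume a b := fun a b => hhc.intervalIntegrable a b
  have hTd : ∀ a, HasDerivAt T (h a) a := fun a =>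
    intervalIntegral.integral_hasDerivAt_right (hint _ _)
      (hhc.stronglyMeasurableAtFilter _ _) hhc.continuousAt
  have hT0 : T 0 = 0 := by simp [hT]
  have hTodd : ∀ a, T (-a) = - T a := by
    intro a
    have := intervalIntegral.integral_comp_neg (a := 0) (b := a) (f := h)
    simp only [hheven, neg_zero] at this
    simp only [hT]
    rw [this, intervalIntegral.integral_symm]
  have hTmono : StrictMono T := by
    intro a b hab
    have h1 : T b - T a = ∫ x in a..b, h x :=
      intervalIntegral.integral_interval_sub_left (hint _ _) (hint _ _)
    have h2 : 0 < ∫ x in a..b, h x := by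
      refine intervalIntegral.integral_pos hab hhc.continuousOn (fun x _ => hh0 x) ?_
      by_cases ha : a = 0
      · exact ⟨b, ⟨hab.le, le_rfl⟩, hhpos b (by linarith)⟩
      · exact ⟨a, ⟨le_rfl, hab.le⟩, hhpos a ha⟩
    linarith
  have hTc : Continuous T := continuous_iff_continuousAt.2 fun a => (hTd a).continuousAt
  have hTtop : Tendsto T atTop atTop := by
    have h1 : Tendsto (fun a : ℝ => h 1 * (a - 1) + T 1) atTop atTop := by
      refine tendsto_atTop_add_const_right _ _ ?_
      refine Tendsto.const_mul_atTop (hhpos 1 one_ne_zero) ?_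
      exact tendsto_atTop_add_const_right _ _ tendsto_id
    refine tendsto_atTop_mono' _ ?_ h1
    filter_upwards [eventually_ge_atTop 1] with a ha
    have h2 : T a - T 1 = ∫ x in (1 : ℝ)..a, h x :=
      intervalIntegral.integral_interval_sub_left (hint _ _) (hint _ _)
    have h3 : ∫ x in (1 : ℝ)..a, h 1 ≤ ∫ x in (1 : ℝ)..a, h x :=
      intervalIntegral.integral_mono_on ha (by simp) (hint _ _) fun x hx => hhbig x hx.1
    simp only [intervalIntegral.integral_const, smul_eq_mul] at h3
    linarith
  have hTbot : Tendsto T atBot atBot := by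
    have h1 : Tendsto (fun a => - T (-a)) atBot atBot :=
      tendsto_neg_atTop_atBot.comp (hTtop.comp tendsto_neg_atBot_atTop)
    refine h1.congr fun a => ?_
    rw [hTodd, neg_neg]
  have hTsurj := hTc.surjective hTtop hTbot
  let e : ℝ ≃o ℝ := StrictMono.orderIsoOfSurjective T hTmono hTsurj
  have heT : ∀ x, e x = T x := fun x => rfl
  have hes : ∀ t, T (e.symm t) = t := fun t => e.apply_symm_apply t
  have he0 : e.symm 0 = 0 := by rw [OrderIso.symm_apply_eq, heT, hT0]
  have hepos : ∀ t ∈ Ioi (0 : ℝ), 0 < e.symm t := by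
    intro t ht
    rw [← he0]
    exact e.symm.strictMono ht
  have hec : Continuous e.symm := e.symm.continuous
  refine ⟨e.symm, hec.continuousOn, he0, hepos, e.symm.strictMono.strictMonoOn _, ?_, ?_⟩
  · intro t ht
    set x := e.symm t with hx
    have hx0 : 0 < x := hepos t ht
    have hTa : AnalyticAt ℝ T x := by
      have hρa : AnalyticAt ℂ (rhoC m F) (x : ℂ) := by
        refine DifferentiableOn.analyticAt (s := {z : ℂ | 0 < z.re})
          (fun z hz =>
            (rhoC_diff hm hFcont hFsupp hFpos z hz).differentiableWithinAt) ?_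
        exact (isOpen_lt continuous_const Complex.continuous_re).mem_nhds (by simpa using hx0)
      set DC : ℂ → ℂ := fun z => 4 * π / 3 * (C : ℂ) ^ 2 + 8 * π / 3 * rhoC m F z * z ^ 2
        - κ * z ^ 4 with hDC
      have hDCr : ∀ y : ℝ, DC y = (D y : ℂ) := by
        intro y
        simp only [hDC, hD, frD, rhoC_ofReal]
        push_cast
        rfl
      have hDCa : AnalyticAt ℂ DC (x : ℂ) := by
        rw [hDC]; fun_prop
      refine fr_primitive (g := fun z => z ^ 2 / (DC z) ^ ((1 / 2 : ℝ) : ℂ)) ?_ ?_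
      · refine AnalyticAt.div (by fun_prop) (hDCa.cpow analyticAt_const ?_) ?_
        · rw [hDCr]; simpa using hDpos x
        · rw [hDCr, ← Complex.ofReal_cpow (hDpos x).le]
          exact_mod_cast (Real.rpow_pos_of_pos (hDpos x) _).ne'
      · refine Eventually.of_forall fun y => ?_
        have : ((y : ℂ) ^ 2 / (DC y) ^ ((1 / 2 : ℝ) : ℂ)).re = h y := by
          rw [hDCr, ← Complex.ofReal_cpow (hDpos y).le, ← Real.sqrt_eq_rpow, ← Complex.ofReal_pow,
            ← Complex.ofReal_div, Complex.ofReal_re]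
          rfl
        rw [this]
        exact hTd y
    have hne : h x ≠ 0 := (hhpos x hx0.ne').ne'
    refine OpenPartialHomeomorph.analyticAt_symm e.toHomeomorph.toOpenPartialHomeomorph
      (a := t) (i := ContinuousLinearEquiv.unitsEquivAut ℝ (Units.mk0 (h x) hne)) (by simp) hTa ?_
    have := (hTd x).hasFDerivAt.fderiv
    refine Eq.trans this ?_
    ext
    simp
  · intro t ht
    have hx0 := hepos t ht
    have h1 := HasDerivAt.of_local_left_inverse hec.continuousAt (hTd (e.symm t))
      (hhpos _ hx0.ne').ne' (Eventually.of_forall hes)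
    refine (congrArg (fun d => HasDerivAt e.symm d t) ?_).mpr h1
    set x := e.symm t
    have h2 : 4 * π / 3 * C ^ 2 / x ^ 4 + 8 * π / 3 * vlasovRho m F x / x ^ 2 - κ
        = D x / (x ^ 2) ^ 2 := by
      simp only [hD, frD]
      field_simp
    rw [h2, Real.sqrt_div (hDpos x).le, Real.sqrt_sq (by positivity)]
    simp only [hh, frh]
    rw [inv_div]
end

section
/- Let C > 0, κ ∈ ℝ, δ > 0, and let a₁, a₂ : [0,δ) → [0,∞) be continuous with a₁(0) = a₂(0) = 0, positive and differentiable on (0,δ), each satisfying ȧᵢ(t) = √( (4π/3) C² aᵢ(t)^{−4} + (8π/3) aᵢ(t)^{−2} ρ(aᵢ(t)) − κ ) on (0,δ) (with the expression under the square root positive there). Then a₁ = a₂ on [0,δ). -/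
open MeasureTheory Real Filter Topology Set

lemma aux_integrable (m : ℝ) (F : ℝ → ℝ)
    (hFcont : Continuous F) (hFsupp : HasCompactSupport F) (a : ℝ) :
    Integrable (fun R : ℝ => R ^ 2 * Real.sqrt (m ^ 2 * a ^ 2 + R ^ 2) * F (R ^ 2)) := by
  apply Continuous.integrable_of_hasCompactSupport
  · fun_prop
  · obtain ⟨B, hB⟩ := hFsupp.isCompact.isBounded.exists_norm_le
    apply HasCompactSupport.intro (isCompact_Icc (a := -(|B| + 1)) (b := |B| + 1))
    intro x hx
    have : F (x ^ 2) = 0 := by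
      by_contra h
      apply hx
      have h1 := hB (x ^ 2) (subset_tsupport F h)
      rw [Real.norm_eq_abs, abs_of_nonneg (sq_nonneg x)] at h1
      have h2 := le_abs_self B
      have h3 := abs_nonneg B
      constructor <;> nlinarith
    simp [this]

lemma aux_rho (m : ℝ) (F : ℝ → ℝ)
    (hFcont : Continuous F) (hFsupp : HasCompactSupport F) (hFpos : ∀ x, 0 ≤ F x)
    {x y : ℝ} (hx : 0 < x) (hxy : x ≤ y) :
    vlasovRho m F y / y ^ 2 ≤ vlasovRho m F x / x ^ 2 := by
  have hy : 0 < y := hx.trans_le hxy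
  have hsq : x ^ 2 ≤ y ^ 2 := by gcongr
  have key : (∫ R in Ioi (0 : ℝ), R ^ 2 * Real.sqrt (m ^ 2 * y ^ 2 + R ^ 2) * F (R ^ 2))
      ≤ ∫ R in Ioi (0 : ℝ), (y ^ 2 / x ^ 2) *
        (R ^ 2 * Real.sqrt (m ^ 2 * x ^ 2 + R ^ 2) * F (R ^ 2)) := by
    apply integral_mono
    · exact (aux_integrable m F hFcont hFsupp y).integrableOn
    · exact ((aux_integrable m F hFcont hFsupp x).const_mul _).integrableOn
    · intro R
      have h : Real.sqrt (m ^ 2 * y ^ 2 + R ^ 2)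
          ≤ (y ^ 2 / x ^ 2) * Real.sqrt (m ^ 2 * x ^ 2 + R ^ 2) := by
        apply Real.sqrt_le_iff.2
        refine ⟨by positivity, ?_⟩
        rw [mul_pow, Real.sq_sqrt (by positivity)]
        have hc : 1 ≤ y ^ 2 / x ^ 2 := (one_le_div (by positivity)).2 hsq
        have e : y ^ 2 = (y ^ 2 / x ^ 2) * x ^ 2 := by field_simp
        set c := y ^ 2 / x ^ 2
        rw [e]
        have h1 : 0 ≤ m ^ 2 * x ^ 2 := by positivity
        have h2 : 0 ≤ R ^ 2 := by positivity
        have h3 : c ≤ c ^ 2 := by nlinarith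
        have h4 : 1 ≤ c ^ 2 := by nlinarith
        nlinarith [mul_nonneg (sub_nonneg.2 h3) h1, mul_nonneg (sub_nonneg.2 h4) h2]
      have := mul_le_mul_of_nonneg_left h (mul_nonneg (sq_nonneg R) (hFpos (R ^ 2)))
      dsimp only
      linarith
  rw [integral_const_mul] at key
  unfold vlasovRho
  rw [div_le_div_iff₀ (by positivity) (by positivity)]
  set I := ∫ R in Ioi (0 : ℝ), R ^ 2 * Real.sqrt (m ^ 2 * x ^ 2 + R ^ 2) * F (R ^ 2)
  set J := ∫ R in Ioi (0 : ℝ), R ^ 2 * Real.sqrt (m ^ 2 * y ^ 2 + R ^ 2) * F (R ^ 2)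
  have k2 : J * x ^ 2 ≤ I * y ^ 2 := by
    have := mul_le_mul_of_nonneg_right key (sq_nonneg x)
    have e : y ^ 2 / x ^ 2 * I * x ^ 2 = I * y ^ 2 := by field_simp
    linarith
  have := mul_le_mul_of_nonneg_left k2 (show 0 ≤ 4 * π by positivity)
  linarith

lemma aux_uniq (G : ℝ → ℝ) (hG : AntitoneOn G (Ioi 0)) (δ : ℝ) (a₁ a₂ : ℝ → ℝ)
    (h₁c : ContinuousOn a₁ (Ico (0 : ℝ) δ)) (h₂c : ContinuousOn a₂ (Ico (0 : ℝ) δ))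
    (h₁0 : a₁ 0 = 0) (h₂0 : a₂ 0 = 0)
    (h₁pos : ∀ t ∈ Ioo (0 : ℝ) δ, 0 < a₁ t)
    (h₂pos : ∀ t ∈ Ioo (0 : ℝ) δ, 0 < a₂ t)
    (h₁d : ∀ t ∈ Ioo (0 : ℝ) δ, HasDerivAt a₁ (G (a₁ t)) t)
    (h₂d : ∀ t ∈ Ioo (0 : ℝ) δ, HasDerivAt a₂ (G (a₂ t)) t) :
    EqOn a₁ a₂ (Ico (0 : ℝ) δ) := by
  have hd : ∀ t ∈ Ioo (0 : ℝ) δ, HasDerivAt (fun t => (a₁ t - a₂ t) ^ 2)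
      (2 * (a₁ t - a₂ t) * (G (a₁ t) - G (a₂ t))) t := by
    intro t ht
    have h := ((h₁d t ht).sub (h₂d t ht)).pow 2
    exact h.congr_deriv (by simp)
  have hanti : AntitoneOn (fun t => (a₁ t - a₂ t) ^ 2) (Ico 0 δ) := by
    apply antitoneOn_of_deriv_nonpos (convex_Ico 0 δ)
    · exact (h₁c.sub h₂c).pow 2
    · rw [interior_Ico]
      exact fun t ht => (hd t ht).differentiableAt.differentiableWithinAt
    · rw [interior_Ico]
      intro t ht
      rw [(hd t ht).deriv]
      rcases le_total (a₁ t) (a₂ t) with h | h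
      · have := hG (h₁pos t ht) (h₂pos t ht) h
        nlinarith
      · have := hG (h₂pos t ht) (h₁pos t ht) h
        nlinarith
  intro t ht
  have h := hanti ⟨le_refl 0, ht.1.trans_lt ht.2⟩ ht ht.1
  simp only [h₁0, h₂0] at h
  have : (a₁ t - a₂ t) ^ 2 = 0 := le_antisymm (by simpa using h) (sq_nonneg _)
  exact sub_eq_zero.1 (pow_eq_zero_iff (two_ne_zero) |>.1 this)

/-- uniqueness of the increasing branch of the scale factor with Big Bang
initial condition `a(0) = 0`: two continuous solutions on `[0,δ)` of
`ȧ = √((4π/3)C²a⁻⁴ + (8π/3)a⁻²ρ(a) − κ)` (positive under the square root) with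
`a(0) = 0` coincide. -/
theorem friedmann_uniqueness
    (m : ℝ) (hm : 0 ≤ m) (F : ℝ → ℝ)
    (hFcont : Continuous F) (hFsupp : HasCompactSupport F) (hFpos : ∀ x, 0 ≤ F x)
    (C : ℝ) (hC : 0 < C) (κ : ℝ) (δ : ℝ) (hδ : 0 < δ)
    (a₁ a₂ : ℝ → ℝ)
    (h₁c : ContinuousOn a₁ (Ico (0 : ℝ) δ)) (h₂c : ContinuousOn a₂ (Ico (0 : ℝ) δ))
    (h₁0 : a₁ 0 = 0) (h₂0 : a₂ 0 = 0)
    (h₁pos : ∀ t ∈ Ioo (0 : ℝ) δ, 0 < a₁ t)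
    (h₂pos : ∀ t ∈ Ioo (0 : ℝ) δ, 0 < a₂ t)
    (h₁sqrt : ∀ t ∈ Ioo (0 : ℝ) δ,
      0 < 4 * π / 3 * C ^ 2 / (a₁ t) ^ 4 + 8 * π / 3 * vlasovRho m F (a₁ t) / (a₁ t) ^ 2 - κ)
    (h₂sqrt : ∀ t ∈ Ioo (0 : ℝ) δ,
      0 < 4 * π / 3 * C ^ 2 / (a₂ t) ^ 4 + 8 * π / 3 * vlasovRho m F (a₂ t) / (a₂ t) ^ 2 - κ)
    (h₁d : ∀ t ∈ Ioo (0 : ℝ) δ, HasDerivAt a₁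
      (Real.sqrt (4 * π / 3 * C ^ 2 / (a₁ t) ^ 4
        + 8 * π / 3 * vlasovRho m F (a₁ t) / (a₁ t) ^ 2 - κ)) t)
    (h₂d : ∀ t ∈ Ioo (0 : ℝ) δ, HasDerivAt a₂
      (Real.sqrt (4 * π / 3 * C ^ 2 / (a₂ t) ^ 4
        + 8 * π / 3 * vlasovRho m F (a₂ t) / (a₂ t) ^ 2 - κ)) t) :
    EqOn a₁ a₂ (Ico (0 : ℝ) δ) := by
  refine aux_uniq (fun x => Real.sqrt (4 * π / 3 * C ^ 2 / x ^ 4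
        + 8 * π / 3 * vlasovRho m F x / x ^ 2 - κ)) ?_ δ a₁ a₂ h₁c h₂c h₁0 h₂0 h₁pos h₂pos h₁d h₂d
  intro x hx y hy hxy
  have hx' : 0 < x := hx
  apply Real.sqrt_le_sqrt
  have h1 := mul_le_mul_of_nonneg_left (aux_rho m F hFcont hFsupp hFpos hx' hxy)
    (show 0 ≤ 8 * π / 3 by positivity)
  have h2 : 4 * π / 3 * C ^ 2 / y ^ 4 ≤ 4 * π / 3 * C ^ 2 / x ^ 4 := by gcongr
  rw [mul_div_assoc (8 * π / 3), mul_div_assoc (8 * π / 3)]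
  linarith
end

section
/- Let C > 0 and κ ∈ ℝ. If a(t) > 0, ȧ(t) ≥ 0 and the Friedman equation ȧ(t)² = (4π/3) C² a(t)^{−4} + (8π/3) a(t)^{−2} ρ(a(t)) − κ holds at t, then √(4π/3) · C · a(t)^{−2} ≤ ȧ(t) + √(max(κ,0)). -/
open MeasureTheory Real Filter Topology Set

/-- coercivity inequality (2.9): if at some time the scale-factor value
`a(t) > 0` and its derivative `ȧ(t) ≥ 0` satisfy the Friedman equation
`ȧ(t)² = (4π/3)C²a(t)⁻⁴ + (8π/3)a(t)⁻²ρ(a(t)) − κ`, then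
`√(4π/3)·C·a(t)⁻² ≤ ȧ(t) + √(max(κ,0))`. -/
theorem friedmann_coercivity
    (m : ℝ) (hm : 0 ≤ m) (F : ℝ → ℝ)
    (hFcont : Continuous F) (hFsupp : HasCompactSupport F) (hFpos : ∀ x, 0 ≤ F x)
    (C : ℝ) (hC : 0 < C) (κ : ℝ)
    (a a' : ℝ → ℝ) (t : ℝ)
    (hpos : 0 < a t) (hd : 0 ≤ a' t)
    (hFriedmann : (a' t) ^ 2 =
      4 * π / 3 * C ^ 2 / (a t) ^ 4 + 8 * π / 3 * vlasovRho m F (a t) / (a t) ^ 2 - κ) :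
    Real.sqrt (4 * π / 3) * C / (a t) ^ 2 ≤ a' t + Real.sqrt (max κ 0) := by
  have hrho : 0 ≤ vlasovRho m F (a t) := by
    unfold vlasovRho
    refine mul_nonneg (by positivity) (integral_nonneg fun R => ?_)
    exact mul_nonneg (by positivity) (hFpos _)
  have hterm : 0 ≤ 8 * π / 3 * vlasovRho m F (a t) / (a t) ^ 2 := by positivity
  have hs0 : 0 ≤ Real.sqrt (max κ 0) := Real.sqrt_nonneg _
  have hs : Real.sqrt (max κ 0) ^ 2 = max κ 0 := Real.sq_sqrt (le_max_right _ _)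
  have hk : κ ≤ max κ 0 := le_max_left _ _
  have hl : (Real.sqrt (4 * π / 3) * C / (a t) ^ 2) ^ 2 = 4 * π / 3 * C ^ 2 / (a t) ^ 4 := by
    rw [div_pow, mul_pow, Real.sq_sqrt (by positivity), ← pow_mul]
  refine le_of_abs_le (abs_le_of_sq_le_sq ?_ (by positivity))
  rw [hl]
  nlinarith [mul_nonneg hd hs0]
end

section
/- Let t₀ > 0, c₀ > 0 and let a : (0,t₀] → (0,∞) be increasing and differentiable with ȧ(s) ≥ c₀ a(s)^{−2} for all s ∈ (0,t₀] and a(t₀) ≤ 1. Let σ ∈ (0,2), α ≥ 0, D ≥ 0, and let y : (0,t₀] → [0,∞) be continuous with y(t) ≤ D + ∫_t^{t₀} ( α a(s)^{−3} + a(s)^{−1−σ} ) y(s) ds for all t ∈ (0,t₀]. Then y(t) ≤ K · D · a(t)^{−α/c₀} for all t ∈ (0,t₀], where K = exp( a(t₀)^{2−σ} / (c₀ (2−σ)) ). -/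
open MeasureTheory Real Filter Topology Set

/-- Gronwall estimate with scale-factor weights: if `a : (0,t₀] → (0,∞)`
is increasing and differentiable with `ȧ ≥ c₀ a⁻²` and `a(t₀) ≤ 1`, `0 < σ < 2`,
`α, D ≥ 0`, and a continuous nonnegative `y` satisfies
`y(t) ≤ D + ∫_t^{t₀} (α a(s)⁻³ + a(s)^{−1−σ}) y(s) ds` on `(0,t₀]`, then
`y(t) ≤ K · D · a(t)^{−α/c₀}` with `K = exp(a(t₀)^{2−σ}/(c₀(2−σ)))`. -/
theorem gronwall_scale_factor
    (t₀ c₀ : ℝ) (ht₀ : 0 < t₀) (hc₀ : 0 < c₀)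
    (a a' : ℝ → ℝ)
    (hpos : ∀ s ∈ Ioc (0 : ℝ) t₀, 0 < a s)
    (hmono : MonotoneOn a (Ioc (0 : ℝ) t₀))
    (hderiv : ∀ s ∈ Ioc (0 : ℝ) t₀, HasDerivAt a (a' s) s)
    (hcoer : ∀ s ∈ Ioc (0 : ℝ) t₀, c₀ / (a s) ^ 2 ≤ a' s)
    (ha1 : a t₀ ≤ 1)
    (σ : ℝ) (hσ0 : 0 < σ) (hσ2 : σ < 2)
    (α D : ℝ) (hα : 0 ≤ α) (hD : 0 ≤ D)
    (y : ℝ → ℝ)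
    (hyc : ContinuousOn y (Ioc (0 : ℝ) t₀))
    (hy0 : ∀ t ∈ Ioc (0 : ℝ) t₀, 0 ≤ y t)
    (hy : ∀ t ∈ Ioc (0 : ℝ) t₀,
      y t ≤ D + ∫ s in t..t₀, (α * a s ^ (-3 : ℝ) + a s ^ (-1 - σ)) * y s) :
    ∀ t ∈ Ioc (0 : ℝ) t₀,
      y t ≤ Real.exp (a t₀ ^ (2 - σ) / (c₀ * (2 - σ))) * D * a t ^ (-(α / c₀)) := by
  intro t ht
  have hsub : ∀ s ∈ Icc t t₀, s ∈ Ioc (0 : ℝ) t₀ := fun s hs => ⟨ht.1.trans_le hs.1, hs.2⟩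
  have h2σ : 0 < 2 - σ := by linarith
  set g : ℝ → ℝ := fun s => α * a s ^ (-3 : ℝ) + a s ^ (-1 - σ) with hg
  have hac : ContinuousOn a (Ioc (0 : ℝ) t₀) :=
    fun s hs => (hderiv s hs).continuousAt.continuousWithinAt
  have hgc : ContinuousOn g (Ioc (0 : ℝ) t₀) := by
    apply ContinuousOn.add
    · exact continuousOn_const.mul (hac.rpow_const fun s hs => Or.inl (hpos s hs).ne')
    · exact hac.rpow_const fun s hs => Or.inl (hpos s hs).ne'
  have hfc : ContinuousOn (fun s => g s * y s) (Ioc (0 : ℝ) t₀) := hgc.mul hyc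
  have hint : ∀ s ∈ Icc t t₀, IntervalIntegrable (fun s => g s * y s) volume s t₀ := by
    intro s hs
    apply ContinuousOn.intervalIntegrable
    rw [uIcc_of_le hs.2]
    exact hfc.mono fun x hx => hsub x ⟨hs.1.trans hx.1, hx.2⟩
  set U : ℝ → ℝ := fun s => D + ∫ x in s..t₀, g x * y x with hU
  set Φ : ℝ → ℝ := fun s => α / c₀ * Real.log (a s) + a s ^ (2 - σ) / (c₀ * (2 - σ)) with hΦ
  have hUc : ContinuousOn U (Icc t t₀) := by
    apply continuousOn_const.add
    have h := intervalIntegral.continuousOn_primitive_interval_left (μ := volume)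
      (f := fun s => g s * y s) (a := t) (b := t₀) (by
        rw [uIcc_of_le ht.2]
        exact (hfc.mono fun x hx => hsub x hx).integrableOn_Icc)
    rwa [uIcc_of_le ht.2] at h
  have hΦd : ∀ s ∈ Ioc (0 : ℝ) t₀,
      HasDerivAt Φ (a' s * (α / c₀ * (a s)⁻¹ + a s ^ (1 - σ) / c₀)) s := by
    intro s hs
    have h1 := ((hderiv s hs).log (hpos s hs).ne').const_mul (α / c₀)
    have h2 := ((hderiv s hs).rpow_const (p := 2 - σ) (Or.inl (hpos s hs).ne')).div_const
      (c₀ * (2 - σ))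
    refine (h1.add h2).congr_deriv ?_
    rw [show 2 - σ - 1 = 1 - σ by ring]
    field_simp
  have hΦg : ∀ s ∈ Ioc (0 : ℝ) t₀,
      g s ≤ a' s * (α / c₀ * (a s)⁻¹ + a s ^ (1 - σ) / c₀) := by
    intro s hs
    have hp := hpos s hs
    have hnn : 0 ≤ α / c₀ * (a s)⁻¹ + a s ^ (1 - σ) / c₀ := by positivity
    refine le_trans (le_of_eq ?_) (mul_le_mul_of_nonneg_right (hcoer s hs) hnn)
    have e1 : a s ^ (-3 : ℝ) = ((a s) ^ 3)⁻¹ := by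
      rw [Real.rpow_neg hp.le]; norm_cast
    have e2 : a s ^ (-1 - σ) = a s ^ (1 - σ) / (a s) ^ 2 := by
      rw [show -1 - σ = (1 - σ) - (2 : ℝ) by ring, Real.rpow_sub hp]; norm_cast
    simp only [hg]
    rw [e1, e2]
    field_simp
  have hg0 : ∀ s ∈ Ioc (0 : ℝ) t₀, 0 ≤ g s := by
    intro s hs
    have hp := hpos s hs
    simp only [hg]
    positivity
  have hmonoW : MonotoneOn (fun s => U s * Real.exp (Φ s)) (Icc t t₀) := by
    have hd : ∀ s ∈ Ioo t t₀, HasDerivAt (fun s => U s * Real.exp (Φ s))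
        (-(g s * y s) * Real.exp (Φ s) + U s * (Real.exp (Φ s) *
          (a' s * (α / c₀ * (a s)⁻¹ + a s ^ (1 - σ) / c₀)))) s := by
      intro s hs
      have hs' := hsub s (Ioo_subset_Icc_self hs)
      have hfo : ContinuousOn (fun s => g s * y s) (Ioo t t₀) :=
        hfc.mono fun x hx => hsub x (Ioo_subset_Icc_self hx)
      have h1 : HasDerivAt U (-(g s * y s)) s :=
        (intervalIntegral.integral_hasDerivAt_left (hint s (Ioo_subset_Icc_self hs))
          (hfo.stronglyMeasurableAtFilter isOpen_Ioo s hs)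
          (hfo.continuousAt (isOpen_Ioo.mem_nhds hs))).const_add D
      exact h1.mul (hΦd s hs').exp
    apply monotoneOn_of_deriv_nonneg (convex_Icc t t₀)
    · exact hUc.mul (Real.continuous_exp.comp_continuousOn
        fun s hs => (hΦd s (hsub s hs)).continuousAt.continuousWithinAt)
    · rw [interior_Icc]
      exact fun s hs => (hd s hs).differentiableAt.differentiableWithinAt
    · rw [interior_Icc]
      intro s hs
      have hs' := hsub s (Ioo_subset_Icc_self hs)
      rw [(hd s hs).deriv]
      have h1 : y s ≤ U s := hy s hs'
      have h2 : g s * y s ≤ U s * (a' s * (α / c₀ * (a s)⁻¹ + a s ^ (1 - σ) / c₀)) :=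
        calc g s * y s ≤ g s * U s := mul_le_mul_of_nonneg_left h1 (hg0 s hs')
          _ = U s * g s := mul_comm _ _
          _ ≤ _ := mul_le_mul_of_nonneg_left (hΦg s hs') ((hy0 s hs').trans h1)
      have h3 := mul_le_mul_of_nonneg_right h2 (Real.exp_pos (Φ s)).le
      linarith
  have hW := hmonoW (left_mem_Icc.2 ht.2) (right_mem_Icc.2 ht.2) ht.2
  have hUt : U t₀ = D := by simp [hU]
  simp only [hUt] at hW
  have hpt := hpos t ht
  have hp0 := hpos t₀ ⟨ht₀, le_rfl⟩
  have hyU : y t ≤ U t := hy t ht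
  have hU0 : 0 ≤ U t := (hy0 t ht).trans hyU
  have e1 : Real.exp (Φ t₀) ≤ Real.exp (a t₀ ^ (2 - σ) / (c₀ * (2 - σ))) := by
    apply Real.exp_le_exp.2
    have : α / c₀ * Real.log (a t₀) ≤ 0 :=
      mul_nonpos_of_nonneg_of_nonpos (by positivity) (Real.log_nonpos hp0.le ha1)
    simp only [hΦ]
    linarith
  have e2 : a t ^ (α / c₀) ≤ Real.exp (Φ t) := by
    rw [Real.rpow_def_of_pos hpt]
    apply Real.exp_le_exp.2
    have : 0 ≤ a t ^ (2 - σ) / (c₀ * (2 - σ)) := by positivity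
    simp only [hΦ]
    linarith
  rw [Real.rpow_neg hpt.le, ← div_eq_mul_inv, le_div_iff₀ (by positivity)]
  calc y t * a t ^ (α / c₀) ≤ U t * Real.exp (Φ t) := by gcongr
    _ ≤ D * Real.exp (Φ t₀) := hW
    _ ≤ D * Real.exp (a t₀ ^ (2 - σ) / (c₀ * (2 - σ))) := by gcongr
    _ = _ := mul_comm _ _
end
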